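/- Let (R,m) be a Noetherian complete local ring that is equidimensional, with minimal primes P₁,…,P_n. For each i, let B_i be a balanced big Cohen–Macaulay algebra over R/P_i. Then every system of parameters of R is a system of parameters of each R/P_i, each B_i is a balanced big Cohen–Macaulay R-algebra, and the product B = ∏_{i=1}^n B_i is a balanced big Cohen–Macaulay R-algebra. -/

import Mathlib

open IsLocalRing

universe u

section BasicDefs

variable (R : Type*) [CommRing R]

/-- The length of a module, i.e. the Krull dimension of its lattice of submodules. -/
noncomputable def moduleLength (M : Type*) [AddCommGroup M] [Module R M] : WithBot ℕ∞ :=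
  Order.krullDim (Submodule R M)

/-- A system of parameters of a Noetherian local ring: `d` elements generating an
ideal whose radical is the maximal ideal, where `d` is the Krull dimension. -/
def IsSOP [IsLocalRing R] {d : ℕ} (x : Fin d → R) : Prop :=
  ringKrullDim R = (d : WithBot ℕ∞) ∧
    (Ideal.span (Set.range x)).radical = maximalIdeal R

/-- A parameter ideal is an ideal generated by a system of parameters. -/
def IsParameterIdeal [IsLocalRing R] (Q : Ideal R) : Prop :=
  ∃ (d : ℕ) (x : Fin d → R), IsSOP R x ∧ Q = Ideal.span (Set.range x)

/-- `f : R →+* B` makes `B` a balanced big Cohen-Macaulay `R`-algebra if every system of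
parameters of `R` maps to a regular sequence on `B` and `m·B ≠ B`. -/
def IsBalancedBigCMHom [IsLocalRing R] {B : Type*} [CommRing B] (f : R →+* B) : Prop :=
  (∀ (d : ℕ) (x : Fin d → R), IsSOP R x →
      RingTheory.Sequence.IsRegular B (List.ofFn fun i => f (x i))) ∧
    (maximalIdeal R).map f ≠ ⊤

/-- A balanced big Cohen-Macaulay algebra. -/
def IsBalancedBigCM [IsLocalRing R] (B : Type*) [CommRing B] [Algebra R B] : Prop :=
  IsBalancedBigCMHom R (algebraMap R B)

/-- The integral closure of an ideal `I`, as a set: all `x` satisfying an equation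
`x^n + a₁ x^{n-1} + ⋯ + aₙ = 0` with `aₖ ∈ I^k`. -/
def intClSet (I : Ideal R) : Set R :=
  { x | ∃ n : ℕ, 0 < n ∧ ∃ a : ℕ → R,
      (∀ k ∈ Finset.Icc 1 n, a k ∈ I ^ k) ∧
      x ^ n + ∑ k ∈ Finset.Icc 1 n, a k * x ^ (n - k) = 0 }

/-- `I^B := IB ∩ R`, the contraction of the extension of `I` along `f : R →+* B`. -/
def contractedExt {B : Type*} [CommRing B] (f : R →+* B) (I : Ideal R) : Ideal R :=
  (I.map f).comap f

/-- Condition (†): `I^B ⊆ \bar I` for every m-primary ideal `I`. -/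
def SatisfiesDagger [IsLocalRing R] {B : Type*} [CommRing B] (f : R →+* B) : Prop :=
  ∀ I : Ideal R, I.radical = maximalIdeal R →
    (contractedExt R f I : Set R) ⊆ intClSet R I

/-- `e` is the family of Hilbert coefficients of the filtration `J` (in dimension `d`):
for `n ≫ 0`, `ℓ(R/J (n+1)) = ∑_{i≤d} (-1)^i e i * choose (n+d-i) (d-i)`. -/
def HasHilbertSeries (d : ℕ) (J : ℕ → Ideal R) (e : ℕ → ℤ) : Prop :=
  ∃ N : ℕ, ∀ n ≥ N, ∃ m : ℕ,
    moduleLength R (R ⧸ J (n + 1)) = (m : WithBot ℕ∞) ∧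
    (m : ℤ) = ∑ i ∈ Finset.range (d + 1),
      (-1) ^ i * e i * ((n + d - i).choose (d - i) : ℤ)

/-- Module version of `HasHilbertSeries`, for the `J`-adic filtration of a module `M`. -/
def HasHilbertSeriesMod (M : Type*) [AddCommGroup M] [Module R M] (d : ℕ)
    (J : Ideal R) (e : ℕ → ℤ) : Prop :=
  ∃ N : ℕ, ∀ n ≥ N, ∃ m : ℕ,
    moduleLength R (M ⧸ (J ^ (n + 1) • (⊤ : Submodule R M))) = (m : WithBot ℕ∞) ∧
    (m : ℤ) = ∑ i ∈ Finset.range (d + 1),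
      (-1) ^ i * e i * ((n + d - i).choose (d - i) : ℤ)


/-- The limit closure `(x₁,…,x_d)^{lim} = ⋃ₜ ((x₁^{t+1},…,x_d^{t+1}) : (x₁⋯x_d)^t)`. -/
def limitClosure {d : ℕ} (x : Fin d → R) : Ideal R :=
  ⨆ t : ℕ, (Ideal.span (Set.range fun i => x i ^ (t + 1))).colon
    (Ideal.span {(∏ i, x i) ^ t})

/-- A ring is equidimensional if `dim (R/P) = dim R` for every minimal prime `P`. -/
def IsEquidimensional : Prop :=
  ∀ P ∈ minimalPrimes R, ringKrullDim (R ⧸ P) = ringKrullDim R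

/-- Depth at least `n`: there is a regular sequence of length `n` in the
(Jacobson) radical, i.e. in the maximal ideal when `R` is local. -/
def HasDepthGE (n : ℕ) : Prop :=
  ∃ rs : List R, rs.length = n ∧ (∀ r ∈ rs, r ∈ (⊥ : Ideal R).jacobson) ∧
    RingTheory.Sequence.IsRegular R rs

/-- A Cohen-Macaulay (Noetherian) local ring: depth = dimension. -/
def IsCohenMacaulayLocalRing : Prop :=
  IsLocalRing R ∧ IsNoetherianRing R ∧
    ∃ d : ℕ, ringKrullDim R = (d : WithBot ℕ∞) ∧ HasDepthGE R d

/-- Serre's condition S₂: for every prime `P`,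
`depth R_P ≥ min 2 (dim R_P)`. -/
def SerreS2 : Prop :=
  ∀ (P : Ideal R) (hP : P.IsPrime) (n : ℕ),
    (n : WithBot ℕ∞) ≤ min 2 (ringKrullDim (Localization.AtPrime P)) →
    HasDepthGE (Localization.AtPrime P) n

/-- A regular local ring: a Noetherian local ring whose maximal ideal is generated
by `dim R` elements. -/
def IsRegularLocal : Prop :=
  IsLocalRing R ∧ IsNoetherianRing R ∧ ∃ (d : ℕ) (x : Fin d → R),
    ringKrullDim R = (d : WithBot ℕ∞) ∧
      Ideal.span (Set.range x) = (⊥ : Ideal R).jacobson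

/-- A regular (not necessarily local) ring: Noetherian and all localizations at
primes are regular local rings. -/
def IsRegularRingOrig : Prop :=
  IsNoetherianRing R ∧
    ∀ (P : Ideal R) (hP : P.IsPrime), IsRegularLocal (Localization.AtPrime P)

/-- The tight closure of an ideal `I` in characteristic `p`, as a set. -/
def tightClSet (p : ℕ) (I : Ideal R) : Set R :=
  { x | ∃ c : R, (∀ P ∈ minimalPrimes R, c ∉ P) ∧
      ∃ E : ℕ, ∀ e ≥ E, c * x ^ p ^ e ∈ Ideal.span ((fun a => a ^ p ^ e) '' (I : Set R)) }

/-- F-rationality: every parameter ideal is tightly closed. -/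
def IsFRational [IsLocalRing R] (p : ℕ) : Prop :=
  ∀ Q : Ideal R, IsParameterIdeal R Q → tightClSet R p Q ⊆ (Q : Set R)

end BasicDefs

section Excellence

open TensorProduct

/-- Geometrically regular `k`-algebra (for `k` a field): `L ⊗[k] A` is regular
for every finite field extension `L` of `k`. -/
def IsGeometricallyRegular (k : Type u) (A : Type u) [CommRing k] [CommRing A]
    [Algebra k A] : Prop :=
  ∀ (L : Type u) [Field L] [Algebra k L], Module.Finite k L → IsRegularRingOrig (L ⊗[k] A)

/-- `R` is a G-ring: for every prime `p`, the fibers of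
`R_p → (R_p)^∧` are geometrically regular. -/
def IsGRing (R : Type u) [CommRing R] : Prop :=
  ∀ (p : Ideal R) (hp : p.IsPrime) (q : Ideal (Localization.AtPrime p)) (hq : q.IsPrime),
    IsGeometricallyRegular
      (ResidueField (Localization.AtPrime q))
      ((ResidueField (Localization.AtPrime q))
        ⊗[Localization.AtPrime p]
        AdicCompletion (maximalIdeal (Localization.AtPrime p)) (Localization.AtPrime p))

/-- `R` is J-2: the regular locus of every finitely generated `R`-algebra is open. -/
def IsJ2 (R : Type u) [CommRing R] : Prop :=
  ∀ (A : Type u) [CommRing A] [Algebra R A], Algebra.FiniteType R A →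
    IsOpen { P : PrimeSpectrum A | IsRegularLocal (Localization.AtPrime P.asIdeal) }

/-- A catenary ring: any two saturated chains of primes with the same endpoints
have the same length. -/
def IsCatenary (A : Type*) [CommRing A] : Prop :=
  ∀ c₁ c₂ : LTSeries (PrimeSpectrum A),
    c₁.head = c₂.head → c₁.last = c₂.last →
    (∀ i : Fin c₁.length, c₁.toFun i.castSucc ⋖ c₁.toFun i.succ) →
    (∀ i : Fin c₂.length, c₂.toFun i.castSucc ⋖ c₂.toFun i.succ) →
    c₁.length = c₂.length

/-- Universally catenary: every finitely generated `R`-algebra is catenary. -/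
def IsUniversallyCatenary (R : Type u) [CommRing R] : Prop :=
  ∀ (A : Type u) [CommRing A] [Algebra R A], Algebra.FiniteType R A → IsCatenary A

/-- An excellent ring: Noetherian, a G-ring, J-2 and universally catenary. -/
def IsExcellentRing (R : Type u) [CommRing R] : Prop :=
  IsNoetherianRing R ∧ IsGRing R ∧ IsJ2 R ∧ IsUniversallyCatenary R

end Excellence

/-- `R` is BCM_B-rational (in dimension `d`): Cohen-Macaulay and the natural map
`H^d_m(R) → H^d_m(B)` is injective. -/
def IsBCMRational (R : Type u) [CommRing R] [IsLocalRing R]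
    (B : Type u) [CommRing B] [Algebra R B] (d : ℕ) : Prop :=
  IsCohenMacaulayLocalRing R ∧
    Function.Injective
      ((localCohomology (maximalIdeal R) d).map (ModuleCat.ofHom (Algebra.linearMap R B)))

theorem aux_mem_ofList_pi {ι : Type*} {B : ι → Type*} [∀ i, CommRing (B i)]
    (l : List (∀ i, B i)) (b : ∀ i, B i) :
    b ∈ Ideal.ofList l ↔ ∀ i, b i ∈ Ideal.ofList (l.map (Pi.evalRingHom B i)) := by
  constructor
  · intro h i
    rw [← Ideal.map_ofList]
    exact Ideal.mem_map_of_mem (Pi.evalRingHom B i) h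
  · induction l generalizing b with
    | nil =>
      intro h
      have h2 : b = 0 := by
        funext i
        simpa using h i
      rw [h2]
      exact Ideal.zero_mem _
    | cons a l ih =>
      intro h
      have h' : ∀ i, ∃ c : B i, ∃ y ∈ Ideal.ofList (l.map (Pi.evalRingHom B i)),
          c * a i + y = b i := by
        intro i
        have := h i
        rw [List.map_cons, Ideal.ofList_cons] at this
        exact Ideal.mem_span_singleton_sup.mp this
      choose c y hy hcy using h'
      rw [Ideal.ofList_cons]
      exact Ideal.mem_span_singleton_sup.mpr ⟨c, y, ih y hy, funext hcy⟩

theorem aux_weaklyRegular_iff {B : Type*} [CommRing B] (l : List B) :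
    RingTheory.Sequence.IsWeaklyRegular B l ↔
      ∀ i (h : i < l.length) (b : B), l[i] * b ∈ Ideal.ofList (l.take i) →
        b ∈ Ideal.ofList (l.take i) := by
  rw [RingTheory.Sequence.isWeaklyRegular_iff]
  refine forall_congr' fun i => forall_congr' fun h => ?_
  rw [isSMulRegular_quotient_iff_mem_of_smul_mem]
  simp only [smul_eq_mul, Ideal.mul_top]

theorem aux_weaklyRegular_pi {ι : Type*} {B : ι → Type*} [∀ i, CommRing (B i)]
    (l : List (∀ i, B i))
    (h : ∀ i, RingTheory.Sequence.IsWeaklyRegular (B i) (l.map (Pi.evalRingHom B i))) :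
    RingTheory.Sequence.IsWeaklyRegular (∀ i, B i) l := by
  rw [aux_weaklyRegular_iff]
  intro k hk b hb
  rw [aux_mem_ofList_pi] at hb ⊢
  intro i
  have h1 := (aux_weaklyRegular_iff _).mp (h i) k (by simpa using hk) (b i)
  have h2 := hb i
  rw [List.map_take] at h2 ⊢
  apply h1
  rw [List.getElem_map]
  exact h2

theorem aux_isSOP (R : Type*) [CommRing R] [IsLocalRing R] (P : Ideal R)
    [IsLocalRing (R ⧸ P)] (hd : ringKrullDim (R ⧸ P) = ringKrullDim R)
    {d : ℕ} (x : Fin d → R) (hx : IsSOP R x) :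
    IsSOP (R ⧸ P) fun j => Ideal.Quotient.mk P (x j) := by
  refine ⟨hd.trans hx.1, ?_⟩
  have hm := map_maximalIdeal_of_surjective (Ideal.Quotient.mk P) Ideal.Quotient.mk_surjective
  have hs : Ideal.span (Set.range fun j => Ideal.Quotient.mk P (x j)) =
      (Ideal.span (Set.range x)).map (Ideal.Quotient.mk P) := by
    rw [Ideal.map_span, ← Set.range_comp]
    rfl
  rw [hs]
  apply le_antisymm
  · refine (Ideal.IsPrime.radical_le_iff (maximalIdeal.isMaximal (R ⧸ P)).isPrime).mpr ?_
    rw [← hm]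
    apply Ideal.map_mono
    rw [← hx.2]
    exact Ideal.le_radical
  · rw [← hm, ← hx.2]
    exact Ideal.map_radical_le _

/-- **Construction in Lemma 2.1.** Let `R` be complete local Noetherian and
equidimensional with minimal primes `P₁,…,Pₙ`, and let `Bᵢ` be a balanced big
Cohen–Macaulay algebra over `R/Pᵢ`. Then every system of parameters of `R` is one of
each `R/Pᵢ`, each `Bᵢ` is a balanced big Cohen–Macaulay `R`-algebra, and so is
`B = ∏ᵢ Bᵢ`. -/
theorem stmt19 (R : Type u) [CommRing R] [IsLocalRing R] [IsNoetherianRing R]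
    (hcomp : IsAdicComplete (maximalIdeal R) R)
    (hequi : IsEquidimensional R)
    (n : ℕ) (P : Fin n → Ideal R)
    (hmin : ∀ i, P i ∈ minimalPrimes R)
    (hall : ∀ p ∈ minimalPrimes R, ∃ i, p = P i)
    (B : Fin n → Type u) [∀ i, CommRing (B i)]
    [∀ i, IsLocalRing (R ⧸ P i)]
    (f : ∀ i, (R ⧸ P i) →+* B i)
    (hf : ∀ i, IsBalancedBigCMHom (R ⧸ P i) (f i)) :
    (∀ (d : ℕ) (x : Fin d → R), IsSOP R x → ∀ i,
      IsSOP (R ⧸ P i) fun j => Ideal.Quotient.mk (P i) (x j)) ∧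
    (∀ i, IsBalancedBigCMHom R ((f i).comp (Ideal.Quotient.mk (P i)))) ∧
    IsBalancedBigCMHom R (Pi.ringHom fun i => (f i).comp (Ideal.Quotient.mk (P i))) := by
  have hA : ∀ (d : ℕ) (x : Fin d → R), IsSOP R x → ∀ i,
      IsSOP (R ⧸ P i) fun j => Ideal.Quotient.mk (P i) (x j) :=
    fun d x hx i => aux_isSOP R (P i) (hequi _ (hmin i)) x hx
  have hB : ∀ i, IsBalancedBigCMHom R ((f i).comp (Ideal.Quotient.mk (P i))) := by
    intro i
    refine ⟨fun d x hx => (hf i).1 d _ (hA d x hx i), ?_⟩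
    rw [← Ideal.map_map,
      map_maximalIdeal_of_surjective (Ideal.Quotient.mk (P i)) Ideal.Quotient.mk_surjective]
    exact (hf i).2
  refine ⟨hA, hB, ?_⟩
  obtain ⟨p, hp⟩ := Ideal.nonempty_minimalPrimes (I := (⊥ : Ideal R)) bot_ne_top
  obtain ⟨i₀, -⟩ := hall p hp
  have hev : ∀ i, (Pi.evalRingHom B i).comp
      (Pi.ringHom fun i => (f i).comp (Ideal.Quotient.mk (P i))) =
      (f i).comp (Ideal.Quotient.mk (P i)) := fun i => rfl
  constructor
  · intro d x hx
    have hmap : ∀ i, (List.ofFn fun j =>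
        (Pi.ringHom fun i => (f i).comp (Ideal.Quotient.mk (P i))) (x j)).map
          (Pi.evalRingHom B i) =
        List.ofFn fun j => ((f i).comp (Ideal.Quotient.mk (P i))) (x j) := by
      intro i
      rw [List.map_ofFn]
      rfl
    refine ⟨aux_weaklyRegular_pi _ fun i => ?_, ?_⟩
    · rw [hmap]
      exact ((hB i).1 d x hx).1
    · intro htop
      apply ((hB i₀).1 d x hx).2
      rw [smul_eq_mul, Ideal.mul_top] at htop ⊢
      rw [← hmap, ← Ideal.map_ofList, ← htop, Ideal.map_top]
  · intro htop
    apply (hB i₀).2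
    rw [← hev, ← Ideal.map_map, htop, Ideal.map_top]
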